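/- For every real number p ≥ 1 there exists an integer ℓ ≥ 1 and a finite set W of words over Σ_h such that |W| = 2^{2^{2ℓ}}, the elements of W are pairwise not ℓ-equivalent with respect to L_h, and (2:ℝ)^{2^{2ℓ}} > 2^{p·2^ℓ}. (This is the combinatorial core of Theorem 3.3: the number of ℓ-equivalence classes of L_h exceeds the bound 2^{p·2^ℓ} of Lemma 3.2 for every constant p, whence L_h is not accepted by any deterministic tree-walking-storage automaton in real time.) -/

import Mathlib

/-- The two-letter alphabet `{a, b}`. -/
inductive AB : Type
  | a | b
  deriving DecidableEq

/-- The four-letter alphabet `{α₀, α₁, α₂, α₃}`. -/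
inductive Alpha : Type
  | α0 | α1 | α2 | α3
  deriving DecidableEq

/-- The alphabet `Σ_h = {a, b, $, ♯, α₀, α₁, α₂, α₃}`. -/
inductive SymH : Type
  | a | b | dollar | sharp | α0 | α1 | α2 | α3
  deriving DecidableEq

/-- Embedding of `{a,b}` into `Σ_h`. -/
def embAB : AB → SymH
  | AB.a => SymH.a
  | AB.b => SymH.b

/-- Embedding of `{α₀,α₁,α₂,α₃}` into `Σ_h`. -/
def embAlpha : Alpha → SymH
  | Alpha.α0 => SymH.α0
  | Alpha.α1 => SymH.α1
  | Alpha.α2 => SymH.α2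
  | Alpha.α3 => SymH.α3

/-- The homomorphism `h` on single letters: `h(α₀)=aa`, `h(α₁)=ab`,
`h(α₂)=ba`, `h(α₃)=bb`. -/
def hLetter : Alpha → List AB
  | Alpha.α0 => [AB.a, AB.a]
  | Alpha.α1 => [AB.a, AB.b]
  | Alpha.α2 => [AB.b, AB.a]
  | Alpha.α3 => [AB.b, AB.b]

/-- The homomorphism `h : {α₀,α₁,α₂,α₃}* → {a,b}*`. -/
def hHom (y : List Alpha) : List AB := y.flatMap hLetter

/-- The word `x₁ $ x₂ $ ⋯ $ x_k` over `Σ_h`, for `xs = [x₁,…,x_k]`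
a list of words over `{a,b}`. -/
def encodeXs (xs : List (List AB)) : List SymH :=
  ((xs.map (List.map embAB)).intersperse [SymH.dollar]).flatten

/-- The language
`L_h = { x₁ $ x₂ $ ⋯ $ x_k ♯ y : k ≥ 0, xᵢ ∈ {a,b}*, y ∈ {α₀,α₁,α₂,α₃}*,
∃ j, x_j^R = h(y) }`. -/
def Lh : Set (List SymH) :=
  { w | ∃ (xs : List (List AB)) (y : List Alpha),
      w = encodeXs xs ++ SymH.sharp :: y.map embAlpha ∧
      ∃ x ∈ xs, x.reverse = hHom y }

/-- Two words are `ℓ`-equivalent with respect to a language `L` if appending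
any word of length at most `ℓ` to both leads to the same membership status. -/
def EllEquiv {σ : Type} (L : Set (List σ)) (ℓ : ℕ) (w w' : List σ) : Prop :=
  ∀ u : List σ, u.length ≤ ℓ → (w ++ u ∈ L ↔ w' ++ u ∈ L)

instance : Fintype Alpha where
  elems := {Alpha.α0, Alpha.α1, Alpha.α2, Alpha.α3}
  complete x := by cases x <;> decide

theorem Alpha.card_eq : Fintype.card Alpha = 4 := rfl

theorem embAB_injective : Function.Injective embAB := by
  intro x y h
  cases x <;> cases y <;> simp_all [embAB]

theorem embAlpha_injective : Function.Injective embAlpha := by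
  intro x y h
  cases x <;> cases y <;> simp_all [embAlpha]

theorem hHom_injective : Function.Injective hHom := by
  intro x
  induction x with
  | nil =>
    rintro (_ | ⟨c, y⟩) h
    · rfl
    · cases c <;> simp [hHom, hLetter] at h
  | cons d x ih =>
    rintro (_ | ⟨c, y⟩) h
    · cases d <;> simp [hHom, hLetter] at h
    · have key : d = c ∧ hHom x = hHom y := by
        cases c <;> cases d <;> simp_all [hHom, hLetter]
      rw [key.1, ih key.2]

theorem embAB_ne_dollar (c : AB) : embAB c ≠ SymH.dollar := by
  cases c <;> simp [embAB]

theorem embAB_ne_sharp (c : AB) : embAB c ≠ SymH.sharp := by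
  cases c <;> simp [embAB]

theorem sharp_notMem_encodeXs (xs : List (List AB)) : SymH.sharp ∉ encodeXs xs := by
  intro h
  obtain ⟨l, hl, hs⟩ := List.mem_flatten.1 h
  have key : ∀ ls : List (List SymH), l ∈ ls.intersperse [SymH.dollar] →
      l ∈ ls ∨ l = [SymH.dollar] := by
    intro ls
    induction ls with
    | nil => simp
    | cons a t ih =>
      cases t with
      | nil => simpa using Or.inl
      | cons b t =>
        simp only [List.intersperse_cons_cons, List.mem_cons] at ih ⊢
        tauto
  rcases key _ hl with hl | rfl
  · obtain ⟨x, -, rfl⟩ := List.mem_map.1 hl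
    obtain ⟨c, -, hc⟩ := List.mem_map.1 hs
    exact embAB_ne_sharp c hc
  · simp at hs

theorem sharp_notMem_map_embAlpha (y : List Alpha) : SymH.sharp ∉ y.map embAlpha := by
  intro h
  obtain ⟨c, -, hc⟩ := List.mem_map.1 h
  cases c <;> simp [embAlpha] at hc

theorem splitOn_encodeXs {xs : List (List AB)} (h : xs ≠ []) :
    (encodeXs xs).splitOn SymH.dollar = xs.map (List.map embAB) := by
  refine List.splitOn_intercalate SymH.dollar ?_ (by simpa using h)
  intro l hl hd
  obtain ⟨x, -, rfl⟩ := List.mem_map.1 hl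
  obtain ⟨c, -, hc⟩ := List.mem_map.1 hd
  exact embAB_ne_dollar c hc

theorem encodeXs_injOn : Set.InjOn encodeXs {xs | xs ≠ []} := by
  intro xs hxs ys hys h
  have h' := splitOn_encodeXs hxs
  rw [h, splitOn_encodeXs hys] at h'
  exact (embAB_injective.list_map.list_map h').symm

theorem mem_of_encodeXs_eq {xs ys : List (List AB)} (h : encodeXs xs = encodeXs ys)
    {x : List AB} (hx : x ∈ ys) (hne : x ≠ []) : x ∈ xs := by
  have hys : ys ≠ [] := List.ne_nil_of_mem hx
  rcases eq_or_ne xs [] with rfl | hxs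
  · have : encodeXs ([[]] : List (List AB)) = encodeXs ys := by rw [← h]; rfl
    rw [← encodeXs_injOn (by simp) hys this] at hx
    exact absurd (by simpa using hx) hne
  · rwa [encodeXs_injOn hxs hys h]

theorem encodeXs_sharp_mem_Lh_iff {xs : List (List AB)} {y : List Alpha} (hy : y ≠ []) :
    encodeXs xs ++ SymH.sharp :: y.map embAlpha ∈ Lh ↔ (hHom y).reverse ∈ xs := by
  constructor
  · rintro ⟨ys, z, h, x, hx, hxz⟩
    obtain ⟨h₁, -, h₂⟩ := (List.append_cons_inj_of_notMem
      (sharp_notMem_encodeXs xs) (sharp_notMem_map_embAlpha y)).1 h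
    obtain rfl := embAlpha_injective.list_map h₂
    obtain rfl : x = (hHom y).reverse := by rw [← hxz, List.reverse_reverse]
    refine mem_of_encodeXs_eq h₁ hx fun h₀ => hy (hHom_injective ?_)
    simpa [hHom] using h₀
  · exact fun h => ⟨xs, y, rfl, _, h, List.reverse_reverse _⟩

/-- The word `x₁ $ ⋯ $ x_k ♯`, where the `xᵢ` are the reversed images under `h` of the elements
of `T`. -/
noncomputable def subsetWord {ℓ : ℕ} (T : Finset (Fin ℓ → Alpha)) : List SymH :=
  encodeXs (T.toList.map fun f => (hHom (List.ofFn f)).reverse) ++ [SymH.sharp]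

theorem subsetWord_append_mem_Lh_iff {ℓ : ℕ} (hℓ : 1 ≤ ℓ) (T : Finset (Fin ℓ → Alpha))
    (f : Fin ℓ → Alpha) :
    subsetWord T ++ (List.ofFn f).map embAlpha ∈ Lh ↔ f ∈ T := by
  have hf : List.ofFn f ≠ [] := by
    rw [← List.length_pos_iff, List.length_ofFn]
    exact hℓ
  have inj : Function.Injective fun g : Fin ℓ → Alpha => (hHom (List.ofFn g)).reverse :=
    List.reverse_injective.comp (hHom_injective.comp List.ofFn_injective)
  rw [subsetWord, List.append_assoc, List.singleton_append, encodeXs_sharp_mem_Lh_iff hf,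
    List.mem_map_of_injective (f := fun g : Fin ℓ → Alpha => (hHom (List.ofFn g)).reverse) inj,
    Finset.mem_toList]

theorem eq_of_ellEquiv_subsetWord {ℓ : ℕ} (hℓ : 1 ≤ ℓ) {T T' : Finset (Fin ℓ → Alpha)}
    (h : EllEquiv Lh ℓ (subsetWord T) (subsetWord T')) : T = T' := by
  ext f
  rw [← subsetWord_append_mem_Lh_iff hℓ, ← subsetWord_append_mem_Lh_iff hℓ]
  exact h _ (by simp)

theorem subsetWord_injective {ℓ : ℕ} (hℓ : 1 ≤ ℓ) :
    Function.Injective (subsetWord (ℓ := ℓ)) := fun _ _ h =>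
  eq_of_ellEquiv_subsetWord hℓ fun _ _ => by rw [h]

/-- for every constant `p ≥ 1` there is an `ℓ ≥ 1` together with
`2^(2^(2ℓ))` pairwise non-`ℓ`-equivalent words with respect to `L_h`, where
moreover `2^(2^(2ℓ)) > 2^(p·2^ℓ)`. -/
theorem Lh_exceeds_bound (p : ℝ) (hp : 1 ≤ p) :
    ∃ ℓ : ℕ, 1 ≤ ℓ ∧
      ∃ W : Finset (List SymH), W.card = 2 ^ (2 ^ (2 * ℓ)) ∧
        (∀ w ∈ W, ∀ w' ∈ W, w ≠ w' → ¬ EllEquiv Lh ℓ w w') ∧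
        ((2 : ℝ) ^ (2 ^ (2 * ℓ) : ℕ) > (2 : ℝ) ^ (p * 2 ^ ℓ)) := by
  obtain ⟨ℓ, hpℓ⟩ := pow_unbounded_of_one_lt p one_lt_two
  have hℓ : 1 ≤ ℓ := by
    rw [Nat.one_le_iff_ne_zero]
    rintro rfl
    rw [pow_zero] at hpℓ
    exact hp.not_gt hpℓ
  refine ⟨ℓ, hℓ, Finset.univ.map ⟨subsetWord, subsetWord_injective hℓ⟩, ?_, ?_, ?_⟩
  · simp [Alpha.card_eq, pow_mul]
  · simp only [Finset.mem_map, Finset.mem_univ, true_and, Function.Embedding.coeFn_mk]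
    rintro _ ⟨T, rfl⟩ _ ⟨T', rfl⟩ hne h
    exact hne (congrArg _ (eq_of_ellEquiv_subsetWord hℓ h))
  · rw [← Real.rpow_natCast, gt_iff_lt]
    refine Real.rpow_lt_rpow_of_exponent_lt one_lt_two ?_
    push_cast
    rw [two_mul, pow_add]
    gcongr
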